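/- arXiv:math/0510287 — 6 statements merged into one kernel-verified Lean document; each statement's English description precedes it below -/
import Mathlib

section
/- For every integer N ≥ 1, every γ = (a b; c d) ∈ Γ₀(N), and every τ ∈ ℂ with cτ + d ≠ 0, one has the identity ψ(γ)·(1, τ, −Nτ²)ᵗ = (cτ+d)²·(1, γ·τ, −N(γ·τ)²)ᵗ, where γ·τ = (aτ+b)/(cτ+d) and ψ(γ) = [[d², 2cd, −c²/N], [bd, bc+ad, −ac/N], [−Nb², −2Nab, a²]] acts on column vectors in ℂ³. -/
open Matrix

/-- The twisted symmetric square matrix `ψ(γ)` (with complex entries) attached to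
`γ = (a b; c d)` and a level `N`. -/
noncomputable def psiMatC (N a b c d : ℂ) : Matrix (Fin 3) (Fin 3) ℂ :=
  !![d^2,      2*c*d,    -c^2/N;
     b*d,      b*c+a*d,  -a*c/N;
     -N*b^2,   -2*N*a*b, a^2]

/-- For `N ≥ 1`, `γ = (a b; c d) ∈ Γ₀(N)` and `τ ∈ ℂ` with `cτ + d ≠ 0`:
`ψ(γ)·(1, τ, −Nτ²)ᵗ = (cτ+d)²·(1, γτ, −N(γτ)²)ᵗ`, where `γτ = (aτ+b)/(cτ+d)`. -/
theorem psi_automorphy (N : ℤ) (hN : 1 ≤ N) (a b c d : ℤ)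
    (hdet : a * d - b * c = 1) (hc : N ∣ c) (τ : ℂ)
    (hτ : (c : ℂ) * τ + (d : ℂ) ≠ 0) :
    (psiMatC (N : ℂ) (a : ℂ) (b : ℂ) (c : ℂ) (d : ℂ)).mulVec
        ![1, τ, -(N : ℂ) * τ^2] =
      ((c : ℂ) * τ + (d : ℂ))^2 •
        ![1, ((a : ℂ) * τ + (b : ℂ)) / ((c : ℂ) * τ + (d : ℂ)),
          -(N : ℂ) * (((a : ℂ) * τ + (b : ℂ)) / ((c : ℂ) * τ + (d : ℂ)))^2] := by
  have hN0 : (N : ℂ) ≠ 0 := by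
    have : N ≠ 0 := by omega
    exact_mod_cast this
  have key : ∀ e x : ℂ, e ≠ 0 → e ^ 2 * (x / e) = e * x ∧
      e ^ 2 * (-(N : ℂ) * (x / e) ^ 2) = -(N : ℂ) * x ^ 2 := by
    intro e x he
    constructor <;> field_simp
  obtain ⟨h1, h2⟩ := key _ ((a : ℂ) * τ + (b : ℂ)) hτ
  ext i
  fin_cases i
  · simp [psiMatC, Matrix.mulVec, dotProduct, Fin.sum_univ_three]
    field_simp
    ring
  · simp only [psiMatC, Matrix.mulVec, dotProduct, Fin.sum_univ_three, Pi.smul_apply, smul_eq_mul]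
    refine Eq.trans ?_ h1.symm
    simp
    field_simp
    ring
  · simp only [psiMatC, Matrix.mulVec, dotProduct, Fin.sum_univ_three, Pi.smul_apply, smul_eq_mul]
    refine Eq.trans ?_ h2.symm
    simp
    ring
end

section
/- For every integer N ≥ 2, the following holds: [ g(N) = 0 and ν∞(N) + ν₂(N) + ν₃(N) ≤ 4 ] or [ g(N) = 1 and ν₂(N) = 0 and ν₃(N) = 0 and ν∞(N) = 2 ] if and only if N ∈ {2, 3, 4, 5, 6, 7, 8, 9, 11}. -/
open Finset

/-- Number of cusps of `X₀(N)`: `ν∞(N) = Σ_{d ∣ N} φ(gcd(d, N/d))`. -/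
def nuInf (N : ℕ) : ℕ := ∑ d ∈ N.divisors, Nat.totient (Nat.gcd d (N / d))

/-- Number of elliptic points of order 2 on `X₀(N)`. -/
def nu2 (N : ℕ) : ℤ :=
  if 4 ∣ N then 0
  else ∏ p ∈ N.primeFactors,
    (1 + (if p % 4 = 1 then 1 else if p % 4 = 3 then -1 else (0 : ℤ)))

/-- Number of elliptic points of order 3 on `X₀(N)`. -/
def nu3 (N : ℕ) : ℤ :=
  if 9 ∣ N then 0
  else ∏ p ∈ N.primeFactors,
    (1 + (if p % 3 = 1 then 1 else if p % 3 = 2 then -1 else (0 : ℤ)))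

/-- The genus of the modular curve `X₀(N)`:
`g(N) = 1 + (N/12)·∏_{p ∣ N}(1 + 1/p) − ν₂/4 − ν₃/3 − ν∞/2`. -/
def genusX0 (N : ℕ) : ℚ :=
  1 + (N : ℚ) / 12 * ∏ p ∈ N.primeFactors, (1 + 1 / (p : ℚ))
    - (nu2 N : ℚ) / 4 - (nu3 N : ℚ) / 3 - (nuInf N : ℚ) / 2

lemma nu2_nonneg_aux (N : ℕ) : 0 ≤ nu2 N := by
  unfold nu2
  split_ifs
  · exact le_rfl
  · refine Finset.prod_nonneg fun p _ => ?_
    split_ifs <;> norm_num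

lemma nu3_nonneg_aux (N : ℕ) : 0 ≤ nu3 N := by
  unfold nu3
  split_ifs
  · exact le_rfl
  · refine Finset.prod_nonneg fun p _ => ?_
    split_ifs <;> norm_num

lemma index_ge_aux (N : ℕ) :
    (N : ℚ) ≤ (N : ℚ) * ∏ p ∈ N.primeFactors, (1 + 1 / (p : ℚ)) := by
  refine le_mul_of_one_le_right (by positivity) ?_
  refine Finset.prod_induction _ (fun x : ℚ => 1 ≤ x)
    (fun a b ha hb => one_le_mul_of_one_le_of_one_le ha hb) le_rfl fun p _ => ?_
  have : (0 : ℚ) ≤ 1 / (p : ℚ) := by positivity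
  linarith

lemma level_le_aux (N : ℕ)
    (h : (genusX0 N = 0 ∧ (nuInf N : ℤ) + nu2 N + nu3 N ≤ 4) ∨
      (genusX0 N = 1 ∧ nu2 N = 0 ∧ nu3 N = 0 ∧ nuInf N = 2)) : N ≤ 12 := by
  have hi := index_ge_aux N
  have h2 : (0 : ℚ) ≤ nu2 N := by exact_mod_cast nu2_nonneg_aux N
  have h3 : (0 : ℚ) ≤ nu3 N := by exact_mod_cast nu3_nonneg_aux N
  have key : (N : ℚ) ≤ 12 := by
    rcases h with ⟨hg, hs⟩ | ⟨hg, e2, e3, ei⟩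
    · have hs' : (nuInf N : ℚ) + nu2 N + nu3 N ≤ 4 := by exact_mod_cast hs
      unfold genusX0 at hg
      linarith
    · unfold genusX0 at hg
      rw [e2, e3, ei] at hg
      push_cast at hg
      linarith
  exact_mod_cast key

lemma small_levels_aux : ∀ N ∈ Finset.Icc 2 12,
    (((genusX0 N = 0 ∧ (nuInf N : ℤ) + nu2 N + nu3 N ≤ 4) ∨
      (genusX0 N = 1 ∧ nu2 N = 0 ∧ nu3 N = 0 ∧ nuInf N = 2)) ↔
    N ∈ ({2, 3, 4, 5, 6, 7, 8, 9, 11} : Finset ℕ)) := by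
  decide +kernel

/-- Levels of `(N,1)`-modular D3 variations: `g = 0` and `ν∞ + ν₂ + ν₃ ≤ 4`, or
`g = 1`, `ν₂ = ν₃ = 0` and `ν∞ = 2`, happens exactly for
`N ∈ {2,3,4,5,6,7,8,9,11}`. -/
theorem level_characterization_d1 (N : ℕ) (hN : 2 ≤ N) :
    ((genusX0 N = 0 ∧ (nuInf N : ℤ) + nu2 N + nu3 N ≤ 4) ∨
      (genusX0 N = 1 ∧ nu2 N = 0 ∧ nu3 N = 0 ∧ nuInf N = 2)) ↔
    N ∈ ({2, 3, 4, 5, 6, 7, 8, 9, 11} : Finset ℕ) := by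
  constructor
  · intro h
    exact (small_levels_aux N (Finset.mem_Icc.2 ⟨hN, level_le_aux N h⟩)).1 h
  · intro h
    refine (small_levels_aux N (Finset.mem_Icc.2 ⟨hN, ?_⟩)).2 h
    simp only [Finset.mem_insert, Finset.mem_singleton] at h
    omega
end

section
/- For every integer N ≥ 2, the following holds: g(N) = 0 and ν∞(N) ≤ 3 and ν₃(N) ≤ 1 and ν₂(N) ≤ 7, if and only if N ∈ {2, 3, 4, 5}. -/
open Finset

/-- Levels of `(N,2)`-modular D3 variations: `g = 0`, `ν∞ ≤ 3`, `ν₃ ≤ 1`, `ν₂ ≤ 7`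
happens exactly for `N ∈ {2,3,4,5}`. -/
theorem level_characterization_d2 (N : ℕ) (hN : 2 ≤ N) :
    (genusX0 N = 0 ∧ nuInf N ≤ 3 ∧ nu3 N ≤ 1 ∧ nu2 N ≤ 7) ↔
    N ∈ ({2, 3, 4, 5} : Finset ℕ) := by
  by_cases hB : N < 32
  · interval_cases N <;> decide +kernel
  · constructor
    · rintro ⟨h0, h1, h2, h3⟩
      exfalso
      apply hB
      have hp : (1 : ℚ) ≤ ∏ p ∈ N.primeFactors, (1 + 1 / (p : ℚ)) := by
        calc (1 : ℚ) = ∏ p ∈ N.primeFactors, (1 : ℚ) := by simp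
          _ ≤ _ := Finset.prod_le_prod (fun _ _ => zero_le_one) (fun p _ => by
            have : (0 : ℚ) ≤ 1 / (p : ℚ) := by positivity
            linarith)
      have h1' : (nuInf N : ℚ) ≤ 3 := by exact_mod_cast h1
      have h2' : (nu3 N : ℚ) ≤ 1 := by exact_mod_cast h2
      have h3' : (nu2 N : ℚ) ≤ 7 := by exact_mod_cast h3
      have hm : (N : ℚ) / 12 * 1 ≤ (N : ℚ) / 12 * ∏ p ∈ N.primeFactors, (1 + 1 / (p : ℚ)) :=
        mul_le_mul_of_nonneg_left hp (by positivity)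
      unfold genusX0 at h0
      have : (N : ℚ) < 32 := by linarith
      exact_mod_cast this
    · intro h
      simp at h
      omega
end

section
/- For every integer N ≥ 2, the following holds: g(N) = 0 and ν∞(N) = 2 and ν₃(N) = 1 and ν₂(N) = 0, if and only if N = 3. -/
open Finset

/-- Levels of `(N,3)`-modular D3 variations: `g = 0`, `ν∞ = 2`, `ν₃ = 1`, `ν₂ = 0`
forces `N = 3`. -/
theorem level_characterization_d3 (N : ℕ) (hN : 2 ≤ N) :
    (genusX0 N = 0 ∧ nuInf N = 2 ∧ nu3 N = 1 ∧ nu2 N = 0) ↔ N = 3 := by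
  have p2 : Nat.primeFactors 2 = {2} := Nat.Prime.primeFactors (by norm_num)
  have p3 : Nat.primeFactors 3 = {3} := Nat.Prime.primeFactors (by norm_num)
  have p4 : Nat.primeFactors 4 = {2} := by
    have h := Nat.primeFactors_prime_pow (k := 2) (by norm_num) Nat.prime_two
    simpa using h
  constructor
  · rintro ⟨hg, hi, h3, h2⟩
    have hprod : (1 : ℚ) ≤ ∏ p ∈ N.primeFactors, (1 + 1 / (p : ℚ)) := by
      apply Finset.one_le_prod
      intro p _
      have : (0 : ℚ) ≤ 1 / (p : ℚ) := by positivity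
      linarith
    have hN0 : (0 : ℚ) ≤ (N : ℚ) := by positivity
    have hle : (N : ℚ) ≤ 4 := by
      unfold genusX0 at hg
      rw [hi, h3, h2] at hg
      push_cast at hg
      have := mul_le_mul_of_nonneg_left hprod hN0
      linarith
    have hle' : N ≤ 4 := by exact_mod_cast hle
    interval_cases N
    · simp [nu3, p2] at h3
    · rfl
    · simp [nu3, p4] at h3
  · rintro rfl
    have hi : nuInf 3 = 2 := by decide
    have h3 : nu3 3 = 1 := by simp [nu3, p3]
    have h2 : nu2 3 = 0 := by simp [nu2, p3]
    refine ⟨?_, hi, h3, h2⟩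
    unfold genusX0
    rw [hi, h3, h2, p3]
    norm_num
end

section
/- For every integer N ≥ 2, the following holds: g(N) = 0 and ν∞(N) = 2 and ν₂(N) = 1 and ν₃(N) = 0, if and only if N = 2. -/
open Finset

/-- Levels of `(N,4)`-modular D3 variations: `g = 0`, `ν∞ = 2`, `ν₂ = 1`, `ν₃ = 0`
forces `N = 2`. -/
theorem level_characterization_d4 (N : ℕ) (hN : 2 ≤ N) :
    (genusX0 N = 0 ∧ nuInf N = 2 ∧ nu2 N = 1 ∧ nu3 N = 0) ↔ N = 2 := by
  have h2 : Nat.primeFactors 2 = {2} := Nat.prime_two.primeFactors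
  have h3 : Nat.primeFactors 3 = {3} := Nat.prime_three.primeFactors
  constructor
  · rintro ⟨hg, hi, h2', h3'⟩
    unfold genusX0 at hg
    rw [hi, h2', h3'] at hg
    have hP : (1 : ℚ) ≤ ∏ p ∈ N.primeFactors, (1 + 1 / (p : ℚ)) := by
      refine Finset.prod_induction _ (fun x : ℚ => 1 ≤ x) (fun a b ha hb => one_le_mul_of_one_le_of_one_le ha hb) le_rfl ?_
      intro p _
      have : (0 : ℚ) ≤ 1 / (p : ℚ) := by positivity
      show (1 : ℚ) ≤ 1 + 1 / (p : ℚ)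
      linarith
    have hN0 : (0 : ℚ) ≤ N := by positivity
    have hle : (N : ℚ) ≤ 3 := by
      push_cast at hg
      nlinarith
    have hle' : N ≤ 3 := by exact_mod_cast hle
    interval_cases N
    · rfl
    · exfalso
      simp [nu2, h3] at h2'
  · rintro rfl
    have hi : nuInf 2 = 2 := by decide
    have h2' : nu2 2 = 1 := by simp [nu2, h2]
    have h3' : nu3 2 = 0 := by simp [nu3, h2]
    refine ⟨?_, hi, h2', h3'⟩
    unfold genusX0
    rw [hi, h2', h3', h2]
    norm_num
end

section
/- The polynomial map ℚ⁶ → ℚ⁶ sending (a₀₀, a₁₁, a₀₁, a₁₂, a₀₂, a₀₃) to the tuple ( a₀₀ + a₁₁, a₀₀, a₀₀² + a₁₁² + 4a₀₀a₁₁ − a₁₂ − 2a₀₁, 6a₀₀a₁₁ + a₀₀² − 4a₀₁, a₀₀²a₁₁ + a₁₁²a₀₀ − a₁₂a₀₀ + a₀₂ − a₁₁a₀₁ − a₀₁a₀₀, −a₀₀²a₁₂ + 2a₀₂a₀₀ + a₀₀²a₁₁² − a₀₃ + a₀₁² − 2a₀₁a₁₁a₀₀ ) is injective. Equivalently, a D3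 operator determines its defining parameter set: if two parameter tuples (a₀₀, a₁₁, a₀₁, a₁₂, a₀₂, a₀₃) and (a₀₀', a₁₁', a₀₁', a₁₂', a₀₂', a₀₃') in ℚ⁶ give rise to the same D3 differential operator L, then the tuples are equal. -/
/-- The polynomial map sending the parameters `(a₀₀, a₁₁, a₀₁, a₁₂, a₀₂, a₀₃)` of a D3
operator to the tuple of its essential coefficients. -/
def d3CoeffMap : ℚ × ℚ × ℚ × ℚ × ℚ × ℚ → ℚ × ℚ × ℚ × ℚ × ℚ × ℚ :=
  fun (a00, a11, a01, a12, a02, a03) =>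
    (a00 + a11,
     a00,
     a00^2 + a11^2 + 4*a00*a11 - a12 - 2*a01,
     6*a00*a11 + a00^2 - 4*a01,
     a00^2*a11 + a11^2*a00 - a12*a00 + a02 - a11*a01 - a01*a00,
     -a00^2*a12 + 2*a02*a00 + a00^2*a11^2 - a03 + a01^2 - 2*a01*a11*a00)

/-- A D3 operator determines its defining parameter set: the coefficient map is
injective, i.e. if two parameter tuples give rise to the same D3 differential
operator then they are equal. -/
theorem d3CoeffMap_injective : Function.Injective d3CoeffMap := by
  rintro ⟨a, b, c, d, e, f⟩ ⟨a2, b2, c2, d2, e2, f2⟩ h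
  simp only [d3CoeffMap, Prod.mk.injEq] at h
  obtain ⟨h1, h2, h3, h4, h5, h6⟩ := h
  subst h2
  obtain rfl : b = b2 := by linarith
  obtain rfl : c = c2 := by linarith
  obtain rfl : d = d2 := by linarith
  obtain rfl : e = e2 := by linarith
  obtain rfl : f = f2 := by linarith
  rfl
end
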